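/- For every real number a > 0 that is not an odd integer multiple of π, the integral ∫₀¹ 1/((a² + (ln x)²)²·(1 + x)) dx equals π/(8a³) − tan(a/2)/(4a³) + 2 · Σ_{k=0}^∞ (ln((2k+1)π) − ln a) / (((2k+1)²π² − a²)²). -/

import Mathlib

open Real MeasureTheory
open Filter Topology Set

theorem Complex.tendsto_sum_tan_half {w : ℂ} (hw : ∀ n : ℤ, w ≠ (2 * n + 1) * π) :
    Tendsto (fun N : ℕ ↦ ∑ k ∈ Finset.range N, 4 * w / ((2 * (k : ℂ) + 1) ^ 2 * π ^ 2 - w ^ 2))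
      atTop (𝓝 (Complex.tan (w / 2))) := by
  have hpi : (π : ℂ) ≠ 0 := by exact_mod_cast pi_ne_zero
  set x : ℂ := 1 / 2 - w / (2 * π) with hx
  have hxw : w = (1 - 2 * x) * π := by rw [hx]; field_simp; ring
  have hxZ : x ∈ Complex.integerComplement := by
    rintro ⟨n, hn⟩
    apply hw (-n)
    rw [hxw, ← hn]
    push_cast
    ring
  have hne : ∀ n : ℤ, x + n ≠ 0 := fun n ↦ Complex.integerComplement_add_ne_zero hxZ n
  have hcot : Complex.tan (w / 2) = Complex.cot (π * x) := by
    rw [← Complex.tan_inv_eq_cot, ← Complex.tan_pi_div_two_sub]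
    congr 1
    rw [hxw]; ring
  have hmain := tendsto_logDeriv_euler_cot_sub hxZ
  have hpartial : ∀ N : ℕ,
      ∑ k ∈ Finset.range N, 4 * w / ((2 * (k : ℂ) + 1) ^ 2 * π ^ 2 - w ^ 2) =
        (∑ k ∈ Finset.range N, cotTerm x k + 1 / x - 1 / (x + N)) / π := by
    intro N
    induction N with
    | zero => simp
    | succ N ih =>
      rw [Finset.sum_range_succ, Finset.sum_range_succ, ih]
      have h1 := hne N
      have h3 := hne (-(N + 1))
      push_cast at h1 h3 ⊢
      have h3' : x - (N + 1) ≠ 0 := by simpa [sub_eq_add_neg] using h3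
      have hden : (2 * (N : ℂ) + 1) ^ 2 * π ^ 2 - w ^ 2 =
          -4 * π ^ 2 * ((x + N) * (x - (N + 1))) := by rw [hxw]; ring
      have : 4 * w / ((2 * (N : ℂ) + 1) ^ 2 * π ^ 2 - w ^ 2) =
          (1 / (x - (N + 1)) + 1 / (x + N)) / π := by
        rw [hden, hxw]; field_simp; ring
      rw [this]
      simp only [cotTerm]
      ring
  simp_rw [hpartial, hcot]
  have hzero : Tendsto (fun N : ℕ ↦ 1 / (x + N)) atTop (𝓝 0) := by
    simp_rw [one_div]
    apply tendsto_inv₀_cobounded.comp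
    rw [← tendsto_norm_atTop_iff_cobounded]
    refine tendsto_atTop_mono (f := fun N : ℕ ↦ (N : ℝ) - ‖x‖) (fun N ↦ ?_) ?_
    · have := norm_sub_norm_le (N : ℂ) (-x)
      simpa [add_comm] using this
    · exact tendsto_atTop_add_const_right _ _ tendsto_natCast_atTop_atTop
  have := ((hmain.add_const (1 / x)).sub hzero).div_const (π : ℂ)
  convert this using 2
  field_simp
  ring

theorem summable_one_div_odd_mul_pi_sq :
    Summable fun k : ℕ ↦ 1 / (((2 * (k : ℝ) + 1) * π) ^ 2) := by
  refine .of_nonneg_of_le (fun k ↦ by positivity) (fun k ↦ ?_)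
    ((summable_nat_add_iff 1).2 (summable_one_div_nat_pow.2 one_lt_two))
  have : (k : ℝ) + 1 ≤ (2 * k + 1) * π := by
    nlinarith [pi_gt_three, (k.cast_nonneg : (0 : ℝ) ≤ k)]
  push_cast
  gcongr

theorem Real.hasSum_tan_half {a : ℝ} (ha : ∀ n : ℤ, a ≠ (2 * n + 1) * π) :
    HasSum (fun k : ℕ ↦ 4 * a / (((2 * (k : ℝ) + 1) * π) ^ 2 - a ^ 2)) (Real.tan (a / 2)) := by
  have hs : Summable fun k : ℕ ↦ 4 * a / (((2 * (k : ℝ) + 1) * π) ^ 2 - a ^ 2) := by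
    have hb : Tendsto (fun k : ℕ ↦ ((2 * (k : ℝ) + 1) * π) ^ 2) atTop atTop :=
      (tendsto_pow_atTop two_ne_zero).comp (((tendsto_atTop_add_const_right _ _
        (tendsto_natCast_atTop_atTop.const_mul_atTop two_pos))).atTop_mul_const pi_pos)
    refine .of_norm_bounded_eventually_nat
      (summable_one_div_odd_mul_pi_sq.mul_left (8 * |a|)) ?_
    filter_upwards [hb.eventually_ge_atTop (2 * a ^ 2 + 1)] with k hk
    have h1 : 0 < ((2 * (k : ℝ) + 1) * π) ^ 2 - a ^ 2 := by nlinarith [sq_nonneg a]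
    have h2 : 0 < ((2 * (k : ℝ) + 1) * π) ^ 2 := by positivity
    rw [norm_div, norm_mul, Real.norm_eq_abs, Real.norm_eq_abs, Real.norm_eq_abs, abs_of_pos h1,
      mul_one_div, div_le_div_iff₀ h1 h2]
    norm_num
    nlinarith [abs_nonneg a]
  rw [hs.hasSum_iff_tendsto_nat]
  have h := Complex.tendsto_sum_tan_half (w := a) (fun n h ↦ ha n (by exact_mod_cast h))
  have := (Complex.continuous_re.tendsto _).comp h
  convert this using 1
  · ext N
    simp only [Function.comp]
    rw [← Complex.ofReal_re (∑ k ∈ Finset.range N, _)]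
    congr 1
    push_cast
    exact Finset.sum_congr rfl fun k _ ↦ by rw [mul_pow]
  · rw [← Complex.ofReal_re (Real.tan (a / 2))]
    push_cast
    rfl

theorem Real.hasSum_tanh_half {t : ℝ} (ht : 0 < t) :
    HasSum (fun k : ℕ ↦ 4 * t / (t ^ 2 + ((2 * (k : ℝ) + 1) * π) ^ 2)) (Real.tanh (t / 2)) := by
  rw [hasSum_iff_tendsto_nat_of_nonneg (fun k ↦ by positivity)]
  have h := Complex.tendsto_sum_tan_half (w := t * Complex.I) (fun n h ↦ ht.ne' (by
    simpa using congrArg Complex.im h))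
  have := (Complex.continuous_im.tendsto _).comp h
  convert this using 1
  · ext N
    simp only [Function.comp]
    rw [← Complex.ofReal_re (∑ k ∈ Finset.range N, _), ← Complex.mul_I_im, Complex.ofReal_sum,
      Finset.sum_mul]
    congr 1
    refine Finset.sum_congr rfl fun k _ ↦ ?_
    push_cast
    rw [mul_pow, mul_pow, Complex.I_sq]
    ring
  · rw [mul_div_right_comm, Complex.tan_mul_I, ← Complex.ofReal_re (Real.tanh (t / 2)),
      ← Complex.mul_I_im]
    push_cast
    rfl

theorem hasDerivAt_neg_inv_sq_add_sq {a : ℝ} (ha : 0 < a) (t : ℝ) :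
    HasDerivAt (fun t ↦ -(1 / 2) * (a ^ 2 + t ^ 2)⁻¹) (t / (a ^ 2 + t ^ 2) ^ 2) t := by
  have hpos : 0 < a ^ 2 + t ^ 2 := by positivity
  have h := ((((hasDerivAt_id t).pow 2).const_add (a ^ 2)).inv hpos.ne').const_mul (-(1 / 2))
  refine h.congr_deriv ?_
  simp
  field_simp

theorem tendsto_inv_sq_add_sq_atTop (a : ℝ) :
    Tendsto (fun t : ℝ ↦ (a ^ 2 + t ^ 2)⁻¹) atTop (𝓝 0) :=
  tendsto_inv_atTop_zero.comp
    (tendsto_atTop_add_const_left _ _ (tendsto_pow_atTop two_ne_zero))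

theorem hasDerivAt_arctan_primitive {a : ℝ} (ha : 0 < a) (t : ℝ) :
    HasDerivAt (fun t ↦ t * (a ^ 2 + t ^ 2)⁻¹ / (2 * a ^ 2) + Real.arctan (t / a) / (2 * a ^ 3))
      (1 / (a ^ 2 + t ^ 2) ^ 2) t := by
  have hpos : 0 < a ^ 2 + t ^ 2 := by positivity
  have h := (((hasDerivAt_id t).mul
    ((((hasDerivAt_id t).pow 2).const_add (a ^ 2)).inv hpos.ne')).div_const (2 * a ^ 2)).add
    (((hasDerivAt_id t).div_const a).arctan.div_const (2 * a ^ 3))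
  refine h.congr_deriv ?_
  simp
  field_simp
  ring

theorem tendsto_arctan_primitive_atTop {a : ℝ} (ha : 0 < a) :
    Tendsto (fun t ↦ t * (a ^ 2 + t ^ 2)⁻¹ / (2 * a ^ 2) + Real.arctan (t / a) / (2 * a ^ 3))
      atTop (𝓝 (π / (4 * a ^ 3))) := by
  have h1 : Tendsto (fun t : ℝ ↦ t * (a ^ 2 + t ^ 2)⁻¹) atTop (𝓝 0) := by
    refine squeeze_zero' (g := fun t : ℝ ↦ t⁻¹) ?_ ?_ tendsto_inv_atTop_zero
    · filter_upwards [eventually_gt_atTop 0] with t ht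
      positivity
    · filter_upwards [eventually_gt_atTop 0] with t ht
      rw [← div_eq_mul_inv, inv_eq_one_div, div_le_div_iff₀ (by positivity) ht]
      nlinarith [sq_nonneg a]
  have h2 : Tendsto (fun t ↦ Real.arctan (t / a)) atTop (𝓝 (π / 2)) :=
    (tendsto_arctan_atTop.mono_right nhdsWithin_le_nhds).comp (tendsto_id.atTop_div_const ha)
  convert (h1.div_const (2 * a ^ 2)).add (h2.div_const (2 * a ^ 3)) using 2
  field_simp
  ring

theorem integrableOn_one_div_sq_add_sq_sq {a : ℝ} (ha : 0 < a) :
    IntegrableOn (fun t ↦ 1 / (a ^ 2 + t ^ 2) ^ 2) (Ioi 0) :=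
  integrableOn_Ioi_deriv_of_nonneg' (fun t _ ↦ hasDerivAt_arctan_primitive ha t)
    (fun t _ ↦ by positivity) (tendsto_arctan_primitive_atTop ha)

theorem integral_one_div_sq_add_sq_sq {a : ℝ} (ha : 0 < a) :
    ∫ t in Ioi 0, 1 / (a ^ 2 + t ^ 2) ^ 2 = π / (4 * a ^ 3) := by
  rw [integral_Ioi_of_hasDerivAt_of_nonneg' (fun t _ ↦ hasDerivAt_arctan_primitive ha t)
    (fun t _ ↦ by positivity) (tendsto_arctan_primitive_atTop ha)]
  simp

theorem integrableOn_div_sq_add_sq_sq {a : ℝ} (ha : 0 < a) :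
    IntegrableOn (fun t ↦ t / (a ^ 2 + t ^ 2) ^ 2) (Ioi 0) :=
  integrableOn_Ioi_deriv_of_nonneg' (fun t _ ↦ hasDerivAt_neg_inv_sq_add_sq ha t)
    (fun t ht ↦ div_nonneg (le_of_lt ht) (by positivity))
    ((tendsto_inv_sq_add_sq_atTop a).const_mul _)

theorem hasDerivAt_log_sq_add_sq_primitive {a b : ℝ} (ha : 0 < a) (hb : 0 < b) (hab : a ≠ b)
    (t : ℝ) :
    HasDerivAt (fun t ↦ -(1 / 2) * (a ^ 2 + t ^ 2)⁻¹ / (b ^ 2 - a ^ 2) -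
        Real.log ((a ^ 2 + t ^ 2) / (t ^ 2 + b ^ 2)) / (2 * (b ^ 2 - a ^ 2) ^ 2))
      (t / ((a ^ 2 + t ^ 2) ^ 2 * (t ^ 2 + b ^ 2))) t := by
  have hD : b ^ 2 - a ^ 2 ≠ 0 := by
    rw [sub_ne_zero]
    exact fun h ↦ hab ((pow_left_inj₀ ha.le hb.le two_ne_zero).1 h.symm)
  have h1 : 0 < a ^ 2 + t ^ 2 := by positivity
  have h2 : 0 < t ^ 2 + b ^ 2 := by positivity
  have hsq := (hasDerivAt_id t).pow 2
  have h := ((hasDerivAt_neg_inv_sq_add_sq ha t).div_const (b ^ 2 - a ^ 2)).sub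
    ((((hsq.const_add (a ^ 2)).div (hsq.add_const (b ^ 2)) h2.ne').log
      (div_pos h1 h2).ne').div_const (2 * (b ^ 2 - a ^ 2) ^ 2))
  refine h.congr_deriv ?_
  simp
  field_simp
  ring

theorem tendsto_log_sq_add_sq_primitive_atTop (a b : ℝ) :
    Tendsto (fun t ↦ -(1 / 2) * (a ^ 2 + t ^ 2)⁻¹ / (b ^ 2 - a ^ 2) -
        Real.log ((a ^ 2 + t ^ 2) / (t ^ 2 + b ^ 2)) / (2 * (b ^ 2 - a ^ 2) ^ 2))
      atTop (𝓝 0) := by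
  have hb : Tendsto (fun t : ℝ ↦ (t ^ 2 + b ^ 2)⁻¹) atTop (𝓝 0) := by
    simpa only [add_comm] using tendsto_inv_sq_add_sq_atTop b
  have hratio : Tendsto (fun t : ℝ ↦ (a ^ 2 + t ^ 2) / (t ^ 2 + b ^ 2)) atTop (𝓝 1) := by
    have h := (hb.const_mul (a ^ 2 - b ^ 2)).const_add 1
    rw [mul_zero, add_zero] at h
    refine h.congr' ?_
    filter_upwards [eventually_gt_atTop 0] with t ht
    field_simp
    ring
  have hlog := hratio.log one_ne_zero
  have h := ((tendsto_inv_sq_add_sq_atTop a).const_mul (-(1 / 2))).div_const (b ^ 2 - a ^ 2)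
    |>.sub (hlog.div_const (2 * (b ^ 2 - a ^ 2) ^ 2))
  simpa using h

theorem integrableOn_div_sq_add_sq_sq_mul {a b : ℝ} (ha : 0 < a) (hb : 0 < b) (hab : a ≠ b) :
    IntegrableOn (fun t ↦ t / ((a ^ 2 + t ^ 2) ^ 2 * (t ^ 2 + b ^ 2))) (Ioi 0) :=
  integrableOn_Ioi_deriv_of_nonneg' (fun t _ ↦ hasDerivAt_log_sq_add_sq_primitive ha hb hab t)
    (fun t ht ↦ div_nonneg (le_of_lt ht) (by positivity))
    (tendsto_log_sq_add_sq_primitive_atTop a b)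

theorem integral_div_sq_add_sq_sq_mul {a b : ℝ} (ha : 0 < a) (hb : 0 < b) (hab : a ≠ b) :
    ∫ t in Ioi 0, t / ((a ^ 2 + t ^ 2) ^ 2 * (t ^ 2 + b ^ 2)) =
      1 / (2 * a ^ 2 * (b ^ 2 - a ^ 2)) - (Real.log b - Real.log a) / (b ^ 2 - a ^ 2) ^ 2 := by
  rw [integral_Ioi_of_hasDerivAt_of_nonneg'
    (fun t _ ↦ hasDerivAt_log_sq_add_sq_primitive ha hb hab t)
    (fun t ht ↦ div_nonneg (le_of_lt ht) (by positivity))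
    (tendsto_log_sq_add_sq_primitive_atTop a b)]
  have hlog : Real.log ((a ^ 2 + 0 ^ 2) / (0 ^ 2 + b ^ 2)) =
      2 * (Real.log a - Real.log b) := by
    rw [Real.log_div (by positivity) (by positivity)]
    simp only [ne_eq, OfNat.ofNat_ne_zero, not_false_eq_true, zero_pow, add_zero, zero_add,
      Real.log_pow]
    push_cast
    ring
  have hD : b ^ 2 - a ^ 2 ≠ 0 := by
    rw [sub_ne_zero]
    exact fun h ↦ hab ((pow_left_inj₀ ha.le hb.le two_ne_zero).1 h.symm)
  rw [hlog]
  field_simp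
  ring

theorem hasSum_integral_div_sq_add_sq_sq_mul {a : ℝ} (ha : 0 < a)
    (hodd : ∀ n : ℤ, a ≠ (2 * n + 1) * π) :
    HasSum (fun k : ℕ ↦
        ∫ t in Ioi 0, t / ((a ^ 2 + t ^ 2) ^ 2 * (t ^ 2 + ((2 * (k : ℝ) + 1) * π) ^ 2)))
      (∫ t in Ioi 0, 1 / 4 * (1 / (a ^ 2 + t ^ 2) ^ 2 * Real.tanh (t / 2))) := by
  have hab (k : ℕ) : a ≠ (2 * (k : ℝ) + 1) * π := mod_cast hodd k
  have hf_int (k : ℕ) := integrableOn_div_sq_add_sq_sq_mul ha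
    (by positivity : 0 < (2 * (k : ℝ) + 1) * π) (hab k)
  have hsum : Summable fun k : ℕ ↦ ∫ t in Ioi 0,
      ‖t / ((a ^ 2 + t ^ 2) ^ 2 * (t ^ 2 + ((2 * (k : ℝ) + 1) * π) ^ 2))‖ := by
    refine .of_nonneg_of_le (fun k ↦ integral_nonneg fun t ↦ norm_nonneg _) (fun k ↦ ?_)
      (summable_one_div_odd_mul_pi_sq.mul_left (∫ t in Ioi 0, t / (a ^ 2 + t ^ 2) ^ 2))
    rw [← integral_mul_const]
    refine setIntegral_mono_on (hf_int k).norm ((integrableOn_div_sq_add_sq_sq ha).mul_const _)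
      measurableSet_Ioi fun t (ht : 0 < t) ↦ ?_
    rw [Real.norm_of_nonneg (by positivity), div_mul_div_comm, mul_one]
    gcongr
    nlinarith [sq_nonneg t]
  suffices heq : ∫ t in Ioi 0, 1 / 4 * (1 / (a ^ 2 + t ^ 2) ^ 2 * Real.tanh (t / 2)) =
      ∫ t in Ioi 0, ∑' k : ℕ,
        t / ((a ^ 2 + t ^ 2) ^ 2 * (t ^ 2 + ((2 * (k : ℝ) + 1) * π) ^ 2)) from
    heq ▸ hasSum_integral_of_summable_integral_norm hf_int hsum
  refine setIntegral_congr_fun measurableSet_Ioi fun t (ht : 0 < t) ↦ ?_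
  have := ((Real.hasSum_tanh_half ht).mul_left (1 / 4 * (1 / (a ^ 2 + t ^ 2) ^ 2))).tsum_eq
  rw [← mul_assoc, ← this]
  refine tsum_congr fun k ↦ ?_
  field_simp

theorem integral_comp_exp_neg_Ioi (g : ℝ → ℝ) :
    ∫ x in (0 : ℝ)..1, g x = ∫ t in Ioi 0, Real.exp (-t) * g (Real.exp (-t)) := by
  have himage : (fun t ↦ Real.exp (-t)) '' Ioi 0 = Ioo 0 1 := by
    ext x
    constructor
    · rintro ⟨t, ht, rfl⟩
      exact ⟨Real.exp_pos _, by simpa using ht⟩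
    · rintro ⟨h0, h1⟩
      exact ⟨-Real.log x, by simpa using Real.log_neg h0 h1, by simp [Real.exp_log h0]⟩
  rw [intervalIntegral.integral_of_le zero_le_one, integral_Ioc_eq_integral_Ioo, ← himage,
    integral_image_eq_integral_abs_deriv_smul measurableSet_Ioi
      (fun t _ ↦ (hasDerivAt_neg t).exp.hasDerivWithinAt)
      (fun s _ t _ h ↦ by simpa using h) g]
  simp

theorem Real.exp_neg_div_one_add_exp_neg (t : ℝ) :
    Real.exp (-t) / (1 + Real.exp (-t)) = (1 - Real.tanh (t / 2)) / 2 := by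
  have h : Real.exp (-t) = Real.exp (-(t / 2)) * Real.exp (-(t / 2)) := by
    rw [← Real.exp_add]; ring_nf
  have h' : Real.exp (t / 2) * Real.exp (-(t / 2)) = 1 := by
    rw [← Real.exp_add]; simp
  have h1 := Real.exp_pos (t / 2)
  have h2 := Real.exp_pos (-(t / 2))
  rw [Real.tanh_eq_sinh_div_cosh, Real.sinh_eq, Real.cosh_eq, h]
  generalize Real.exp (t / 2) = u at *
  generalize Real.exp (-(t / 2)) = v at *
  field_simp
  linear_combination (2 * v) * h'

theorem bdh_integral_ten (a : ℝ) (ha : 0 < a)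
    (hodd : ∀ n : ℤ, a ≠ (2 * n + 1) * π) :
    (∫ x in (0:ℝ)..1, 1 / ((a ^ 2 + Real.log x ^ 2) ^ 2 * (1 + x))) =
      π / (8 * a ^ 3) - Real.tan (a / 2) / (4 * a ^ 3) +
        2 * ∑' k : ℕ,
          (Real.log ((2 * k + 1) * π) - Real.log a) /
            ((2 * (k : ℝ) + 1) ^ 2 * π ^ 2 - a ^ 2) ^ 2 := by
  have hg := integrableOn_one_div_sq_add_sq_sq ha
  have htanh : IntegrableOn (fun t ↦ 1 / (a ^ 2 + t ^ 2) ^ 2 * Real.tanh (t / 2)) (Ioi 0) := by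
    refine hg.mul_bdd (c := 1) ?_ (.of_forall fun t ↦ ?_)
    · have : Continuous fun t : ℝ ↦ Real.tanh (t / 2) := by
        simp_rw [Real.tanh_eq_sinh_div_cosh]
        exact (Real.continuous_sinh.comp (continuous_id.div_const 2)).div
          (Real.continuous_cosh.comp (continuous_id.div_const 2)) fun t ↦ (Real.cosh_pos _).ne'
      exact this.aestronglyMeasurable
    · exact (Real.abs_tanh_lt_one _).le
  have hS := hasSum_integral_div_sq_add_sq_sq_mul ha hodd
  have hab (k : ℕ) : a ≠ (2 * (k : ℝ) + 1) * π := mod_cast hodd k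
  simp_rw [fun k : ℕ ↦ integral_div_sq_add_sq_sq_mul ha
    (by positivity : 0 < (2 * (k : ℝ) + 1) * π) (hab k)] at hS
  have hT := ((Real.hasSum_tan_half hodd).mul_left (1 / (8 * a ^ 3))).sub hS
  have hterm : ∀ k : ℕ, (Real.log ((2 * k + 1) * π) - Real.log a) /
      ((2 * (k : ℝ) + 1) ^ 2 * π ^ 2 - a ^ 2) ^ 2 =
      1 / (8 * a ^ 3) * (4 * a / (((2 * (k : ℝ) + 1) * π) ^ 2 - a ^ 2)) -
        (1 / (2 * a ^ 2 * (((2 * (k : ℝ) + 1) * π) ^ 2 - a ^ 2)) -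
          (Real.log ((2 * k + 1) * π) - Real.log a) /
            (((2 * (k : ℝ) + 1) * π) ^ 2 - a ^ 2) ^ 2) := by
    intro k
    rw [← mul_pow]
    generalize ((2 * (k : ℝ) + 1) * π) ^ 2 - a ^ 2 = D
    have : 1 / (8 * a ^ 3) * (4 * a / D) = 1 / (2 * a ^ 2 * D) := by
      field_simp
      norm_num
    rw [this]
    ring
  simp_rw [hterm]
  rw [hT.tsum_eq, integral_comp_exp_neg_Ioi, integral_const_mul]
  have hI : ∫ t in Ioi 0, Real.exp (-t) *
      (1 / ((a ^ 2 + Real.log (Real.exp (-t)) ^ 2) ^ 2 * (1 + Real.exp (-t)))) =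
      ∫ t in Ioi 0, (1 / 2 * (1 / (a ^ 2 + t ^ 2) ^ 2) -
        1 / 2 * (1 / (a ^ 2 + t ^ 2) ^ 2 * Real.tanh (t / 2))) := by
    congr 1
    ext t
    have := Real.exp_neg_div_one_add_exp_neg t
    rw [Real.log_exp, neg_sq]
    calc _ = 1 / (a ^ 2 + t ^ 2) ^ 2 * (Real.exp (-t) / (1 + Real.exp (-t))) := by
          field_simp
      _ = _ := by rw [this]; ring
  rw [hI, integral_sub (hg.const_mul _) (htanh.const_mul _), integral_const_mul,
    integral_const_mul, integral_one_div_sq_add_sq_sq ha]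
  field_simp
  ring
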